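/- arXiv:2406.18735 — 2 statements merged into one kernel-verified Lean document; each statement's English description precedes it below -/
import Mathlib

section
/- Let K : ℝ → ℝ be continuous and without conjugate points, and for r ≠ 0 let J^r be the unique solution of the Jacobi equation with J^r(0) = 1 and J^r(r) = 0. Then for every r > 0 one has (J^r)'(0) < (J^{−1})'(0), where J^{−1} is the unique solution with J^{−1}(0) = 1 and J^{−1}(−1) = 0. -/
open Set MeasureTheory Filter

/-- A solution of the scalar Jacobi equation `J'' + K·J = 0`. -/
def IsJacobiSolution (K J : ℝ → ℝ) : Prop :=
  ContDiff ℝ 2 J ∧ ∀ t : ℝ, deriv (deriv J) t + K t * J t = 0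

/-- `K` is without conjugate points: any solution vanishing at two distinct
points vanishes identically. -/
def WithoutConjugatePoints (K : ℝ → ℝ) : Prop :=
  ∀ J : ℝ → ℝ, IsJacobiSolution K J →
    ∀ a b : ℝ, a ≠ b → J a = 0 → J b = 0 → ∀ t : ℝ, J t = 0

theorem IsJacobiSolution.hasDerivAt {K J : ℝ → ℝ} (h : IsJacobiSolution K J) (t : ℝ) :
    HasDerivAt J (deriv J t) t :=
  (h.1.differentiable (by norm_num) t).hasDerivAt

theorem IsJacobiSolution.hasDerivAt_deriv {K J : ℝ → ℝ} (h : IsJacobiSolution K J) (t : ℝ) :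
    HasDerivAt (deriv J) (-(K t * J t)) t := by
  have h1 : ContDiff ℝ 1 (deriv J) :=
    (contDiff_succ_iff_deriv.1
      (show ContDiff ℝ (1 + 1) J by simpa [one_add_one_eq_two] using h.1)).2.2
  rw [← eq_neg_of_add_eq_zero_left (h.2 t)]
  exact (h1.differentiable (by norm_num) t).hasDerivAt

/-- The Wronskian of two Jacobi solutions is constant. -/
theorem IsJacobiSolution.wronskian_eq {K u v : ℝ → ℝ} (hu : IsJacobiSolution K u)
    (hv : IsJacobiSolution K v) (s t : ℝ) :
    u s * deriv v s - deriv u s * v s = u t * deriv v t - deriv u t * v t := by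
  have hW (x : ℝ) : HasDerivAt (fun y => u y * deriv v y - deriv u y * v y) 0 x :=
    (((hu.hasDerivAt x).mul (hv.hasDerivAt_deriv x)).sub
      ((hu.hasDerivAt_deriv x).mul (hv.hasDerivAt x))).congr_deriv (by ring)
  exact is_const_of_deriv_eq_zero (fun x => (hW x).differentiableAt) (fun x => (hW x).deriv) s t

theorem stmt_7 (K : ℝ → ℝ) (hK : Continuous K)
    (hwcp : WithoutConjugatePoints K)
    (r : ℝ) (hr : 0 < r)
    (Jr : ℝ → ℝ) (hJr : IsJacobiSolution K Jr) (hJr0 : Jr 0 = 1)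
    (hJrr : Jr r = 0)
    (Jneg : ℝ → ℝ) (hJneg : IsJacobiSolution K Jneg) (hJneg0 : Jneg 0 = 1)
    (hJnegm1 : Jneg (-1) = 0) :
    deriv Jr 0 < deriv Jneg 0 := by
  have hne (t : ℝ) (ht : t ≤ 0) : Jr t ≠ 0 := fun h0 => by
    have := hwcp Jr hJr t r (by linarith) h0 hJrr 0
    linarith
  have hquot (t : ℝ) (ht : t ≤ 0) :
      HasDerivAt (fun s => Jneg s / Jr s) ((deriv Jneg 0 - deriv Jr 0) / Jr t ^ 2) t := by
    refine ((hJneg.hasDerivAt t).fun_div (hJr.hasDerivAt t) (hne t ht)).congr_deriv ?_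
    have hW := hJr.wronskian_eq hJneg t 0
    rw [hJr0, hJneg0] at hW
    congr 1
    linarith
  obtain ⟨c, hc, hslope⟩ := exists_hasDerivAt_eq_slope (fun s => Jneg s / Jr s)
    (fun t => (deriv Jneg 0 - deriv Jr 0) / Jr t ^ 2) (show (-1 : ℝ) < 0 by norm_num)
    (fun t ht => (hquot t ht.2).continuousAt.continuousWithinAt)
    (fun t ht => hquot t ht.2.le)
  have hpos : 0 < Jr c ^ 2 := by
    have := hne c hc.2.le
    positivity
  norm_num [hJr0, hJneg0, hJnegm1] at hslope
  rw [div_eq_iff hpos.ne'] at hslope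
  linarith
end

section
/- Let K : ℝ → ℝ be continuous and without conjugate points, for r > 0 let J^r be the unique solution of the Jacobi equation with J^r(0) = 1 and J^r(r) = 0, and let J^{+∞} be the solution with J^{+∞}(0) = 1 and (J^{+∞})'(0) = lim_{r→+∞} (J^r)'(0) (this limit exists). Then J^{+∞}(t) ≠ 0 for every t ∈ ℝ. -/
open Set MeasureTheory Filter

namespace IsJacobiSolution

variable {K u v : ℝ → ℝ}

lemma differentiable (hu : IsJacobiSolution K u) : Differentiable ℝ u :=
  hu.1.differentiable (by norm_num)

lemma differentiable_deriv (hu : IsJacobiSolution K u) : Differentiable ℝ (deriv u) :=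
  ((contDiff_succ_iff_deriv (n := 1)).1 hu.1).2.2.differentiable (by norm_num)

lemma deriv_sub_smul (hu : IsJacobiSolution K u) (hv : IsJacobiSolution K v) (c : ℝ) :
    deriv (fun t => u t - c * v t) = fun t => deriv u t - c * deriv v t := by
  funext t
  exact ((hu.differentiable t).hasDerivAt.sub
    ((hv.differentiable t).hasDerivAt.const_mul c)).deriv

/-- Solutions of the Jacobi equation are closed under linear combinations. -/
lemma sub_smul (hu : IsJacobiSolution K u) (hv : IsJacobiSolution K v) (c : ℝ) :
    IsJacobiSolution K (fun t => u t - c * v t) := by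
  refine ⟨hu.1.sub (contDiff_const.mul hv.1), fun t => ?_⟩
  have h := ((hu.differentiable_deriv t).hasDerivAt.sub
    ((hv.differentiable_deriv t).hasDerivAt.const_mul c)).deriv
  rw [deriv_sub_smul hu hv c]
  change deriv (fun t => deriv u t - c * deriv v t) t = _ at h
  rw [h]
  linear_combination hu.2 t - c * hv.2 t

/-- The Wronskian of two solutions of the Jacobi equation is constant. -/
lemma wronskian_eq_s10 (hu : IsJacobiSolution K u) (hv : IsJacobiSolution K v) (s t : ℝ) :
    u s * deriv v s - deriv u s * v s = u t * deriv v t - deriv u t * v t := by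
  have h : ∀ x, HasDerivAt (fun x => u x * deriv v x - deriv u x * v x) 0 x := fun x => by
    have h1 := ((hu.differentiable x).hasDerivAt.mul (hv.differentiable_deriv x).hasDerivAt).sub
      ((hu.differentiable_deriv x).hasDerivAt.mul (hv.differentiable x).hasDerivAt)
    refine h1.congr_deriv ?_
    linear_combination u x * hv.2 x - v x * hu.2 x
  exact is_const_of_deriv_eq_zero (fun x => (h x).differentiableAt) (fun x => (h x).deriv) s t

/-- Without conjugate points, a solution with vanishing initial data at `0` is zero, provided some
solution has no zero on `[-1, 0]`. -/
lemma eq_zero_of_initial_eq_zero (hwcp : WithoutConjugatePoints K) (hu : IsJacobiSolution K u)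
    (hv : IsJacobiSolution K v) (hv_ne : ∀ t ∈ Icc (-1 : ℝ) 0, v t ≠ 0)
    (h0 : u 0 = 0) (h0' : deriv u 0 = 0) (t : ℝ) : u t = 0 := by
  have hd : ∀ x ∈ Icc (-1 : ℝ) 0, HasDerivAt (fun x => u x / v x) 0 x := fun x hx => by
    refine ((hu.differentiable x).hasDerivAt.div (hv.differentiable x).hasDerivAt
      (hv_ne x hx)).congr_deriv ?_
    have hw := wronskian_eq_s10 hu hv x 0
    rw [h0, h0'] at hw
    rw [div_eq_zero_iff]
    left
    linarith
  obtain ⟨c, hc, hslope⟩ := exists_hasDerivAt_eq_slope (fun x => u x / v x) (fun _ => 0)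
    (by norm_num : (-1 : ℝ) < 0) (fun x hx => (hd x hx).continuousAt.continuousWithinAt)
    (fun x hx => hd x (Ioo_subset_Icc_self hx))
  have h1 : u (-1) = 0 := by
    have := hv_ne (-1) (by norm_num)
    simpa [h0, this] using hslope
  exact hwcp u hu (-1) 0 (by norm_num) h1 h0 t

/-- Without conjugate points, a solution equal to `1` at `0` and vanishing at `r > 0` is positive
to the left of `r`. -/
lemma pos_of_lt (hwcp : WithoutConjugatePoints K) (hu : IsJacobiSolution K u) {r t : ℝ}
    (hr : 0 < r) (h0 : u 0 = 1) (hur : u r = 0) (ht : t < r) : 0 < u t := by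
  by_contra! h
  obtain ⟨z, hz, hz0⟩ := intermediate_value_uIcc (a := t) (b := 0)
    hu.differentiable.continuous.continuousOn
    (mem_uIcc.2 (Or.inl ⟨h, by rw [h0]; exact zero_le_one⟩))
  have hzr : z < r := hz.2.trans_lt (max_lt ht hr)
  have := hwcp u hu z r hzr.ne hz0 hur 0
  linarith

end IsJacobiSolution

theorem stmt_10 (K : ℝ → ℝ) (hK : Continuous K)
    (hwcp : WithoutConjugatePoints K)
    (J : ℝ → ℝ → ℝ)
    (hJ : ∀ r : ℝ, 0 < r →
      IsJacobiSolution K (J r) ∧ J r 0 = 1 ∧ J r r = 0)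
    (Jinf : ℝ → ℝ) (hJinf : IsJacobiSolution K Jinf) (hJinf0 : Jinf 0 = 1)
    (hJinf0' : Tendsto (fun r => deriv (J r) 0) atTop (nhds (deriv Jinf 0))) :
    ∀ t : ℝ, Jinf t ≠ 0 := by
  obtain ⟨h1, h10, h11⟩ := hJ 1 one_pos
  obtain ⟨h2, h20, h22⟩ := hJ 2 two_pos
  have huniq : ∀ u, IsJacobiSolution K u → u 0 = 0 → deriv u 0 = 0 → ∀ t, u t = 0 :=
    fun u hu => hu.eq_zero_of_initial_eq_zero hwcp h1
      fun t ht => (h1.pos_of_lt hwcp one_pos h10 h11 (ht.2.trans_lt one_pos)).ne'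
  obtain ⟨S, hS, hS0, hS0'⟩ : ∃ S, IsJacobiSolution K S ∧ S 0 = 0 ∧ deriv S 0 ≠ 0 := by
    refine ⟨_, h2.sub_smul h1 1, by simp [h10, h20], fun h => ?_⟩
    have h3 := huniq _ (h2.sub_smul h1 1) (by simp [h10, h20]) h 1
    have h4 := h2.pos_of_lt hwcp two_pos h20 h22 one_lt_two
    simp only [h11] at h3
    linarith
  have hrep : ∀ r, 0 < r → ∀ t,
      J r t = Jinf t - (deriv Jinf 0 - deriv (J r) 0) / deriv S 0 * S t := by
    intro r hr t
    obtain ⟨hr1, hr0, -⟩ := hJ r hr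
    have hA := hJinf.sub_smul hS ((deriv Jinf 0 - deriv (J r) 0) / deriv S 0)
    have h := huniq _ (hr1.sub_smul hA 1) (by simp [hr0, hJinf0, hS0]) (by
      rw [hr1.deriv_sub_smul hA, hJinf.deriv_sub_smul hS]
      field_simp
      ring) t
    linarith
  have hnonneg : ∀ t, 0 ≤ Jinf t := by
    intro t
    have hlim : Tendsto (fun r => Jinf t - (deriv Jinf 0 - deriv (J r) 0) / deriv S 0 * S t)
        atTop (nhds (Jinf t)) := by
      simpa using (((hJinf0'.const_sub (deriv Jinf 0)).div_const (deriv S 0)).mul_const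
        (S t)).const_sub (Jinf t)
    refine ge_of_tendsto hlim ?_
    filter_upwards [eventually_gt_atTop 0, eventually_gt_atTop t] with r hr htr
    rw [← hrep r hr t]
    obtain ⟨hr1, hr0, hrr⟩ := hJ r hr
    exact (hr1.pos_of_lt hwcp hr hr0 hrr htr).le
  intro t ht
  have hmin : IsLocalMin Jinf t := Eventually.of_forall fun s => ht ▸ hnonneg s
  have hw := hJinf.wronskian_eq_s10 hS t 0
  rw [ht, hmin.deriv_eq_zero, hJinf0, hS0] at hw
  exact hS0' (by linarith)
end
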